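/- Let N = 11 and let τ be any point of the complex upper half-plane with E₂^{(11)}(τ) ≠ 0. Writing x = a₄(τ) and y = a₆(τ), the following polynomial identity holds: −29241x⁶ − 23955822x⁵ − 1351692x⁴y + 572544x³y² − 15183229435x⁴ + 7092313360x³y − 1934162736x²y² + 235016704xy³ − 10061824y⁴ + 103990630700x³ − 301970625000x²y + 47640642720xy² − 4119072320y³ − 2009614509375x² + 2923075650000xy − 2204530508400y² + 1296871230050x − 5894869227500y + 285311670611 = 0. That is, (a₄, a₆) parametrizes a plane curve satisfying this degree-6 defining equation of X₀(11). -/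

import Mathlib

open Complex UpperHalfPlane Matrix MatrixGroups Filter

/-- `q = e^{2πiτ}`. -/
noncomputable def qExp (τ : ℂ) : ℂ := Complex.exp (2 * Real.pi * Complex.I * τ)

/-- `σ_k(n) = Σ_{d ∣ n} d^k`. -/
def sigma' (k n : ℕ) : ℕ := ∑ d ∈ n.divisors, d ^ k

/-- Normalized Eisenstein series `E₄(τ) = 1 + 240 Σ_{n≥1} σ₃(n) qⁿ`. -/
noncomputable def E4 (τ : ℂ) : ℂ := 1 + 240 * ∑' n : ℕ+, (sigma' 3 n : ℂ) * qExp τ ^ (n : ℕ)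

/-- Normalized Eisenstein series `E₆(τ) = 1 − 504 Σ_{n≥1} σ₅(n) qⁿ`. -/
noncomputable def E6 (τ : ℂ) : ℂ := 1 - 504 * ∑' n : ℕ+, (sigma' 5 n : ℂ) * qExp τ ^ (n : ℕ)

/-- Normalized weight-2 Eisenstein series `E₂(τ) = 1 − 24 Σ_{n≥1} σ₁(n) qⁿ`. -/
noncomputable def E2 (τ : ℂ) : ℂ := 1 - 24 * ∑' n : ℕ+, (sigma' 1 n : ℂ) * qExp τ ^ (n : ℕ)

/-- `E₂^{(N)}(τ) = (N−1)/24 + Σ_{n≥1} σ₁(n)(qⁿ − N q^{Nn})`. -/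
noncomputable def E2N (N : ℕ) (τ : ℂ) : ℂ :=
  ((N : ℂ) - 1) / 24 +
    ∑' n : ℕ+, (sigma' 1 n : ℂ) * (qExp τ ^ (n : ℕ) - (N : ℂ) * qExp τ ^ (N * (n : ℕ)))

/-- `a₄(τ) = −E₄(τ)/(48 E₂^{(N)}(τ)²)`. -/
noncomputable def a4 (N : ℕ) (τ : ℂ) : ℂ := -E4 τ / (48 * E2N N τ ^ 2)

/-- `a₆(τ) = E₆(τ)/(864 E₂^{(N)}(τ)³)`. -/
noncomputable def a6 (N : ℕ) (τ : ℂ) : ℂ := E6 τ / (864 * E2N N τ ^ 3)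

/-- `a₄′(τ) = −E₄(Nτ)/(48 E₂^{(N)}(τ)²)`. -/
noncomputable def a4' (N : ℕ) (τ : ℂ) : ℂ := -E4 ((N : ℂ) * τ) / (48 * E2N N τ ^ 2)

/-- `a₆′(τ) = E₆(Nτ)/(864 E₂^{(N)}(τ)³)`. -/
noncomputable def a6' (N : ℕ) (τ : ℂ) : ℂ := E6 ((N : ℂ) * τ) / (864 * E2N N τ ^ 3)

open scoped ModularForm Topology Manifold

lemma gamma0_coset (γ : SL(2, ℤ)) : γ ∈ CongruenceSubgroup.Gamma0 11 ∨
    ∃ j : Fin 11, γ * (ModularGroup.S * ModularGroup.T ^ (j : ℕ))⁻¹ ∈ CongruenceSubgroup.Gamma0 11 := by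
  by_cases hc : ((γ 1 0 : ℤ) : ZMod 11) = 0
  · left; rwa [CongruenceSubgroup.Gamma0_mem]
  · right
    obtain ⟨j, hj⟩ : ∃ j : ZMod 11, ((γ 1 0 : ℤ) : ZMod 11) * j = ((γ 1 1 : ℤ) : ZMod 11) := by
      have : Fact (Nat.Prime 11) := ⟨by norm_num⟩
      exact ⟨((γ 1 0 : ℤ) : ZMod 11)⁻¹ * ((γ 1 1 : ℤ) : ZMod 11), by field_simp⟩
    refine ⟨⟨j.val, ZMod.val_lt j⟩, ?_⟩
    rw [CongruenceSubgroup.Gamma0_mem]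
    have hT : (((ModularGroup.T ^ j.val : SL(2, ℤ))⁻¹ : SL(2, ℤ)) : Matrix (Fin 2) (Fin 2) ℤ)
        = !![1, -(j.val : ℤ); 0, 1] := by
      have h := ModularGroup.coe_T_zpow (-(j.val : ℤ))
      rwa [_root_.zpow_neg, zpow_natCast] at h
    have hS : ((ModularGroup.S⁻¹ : SL(2, ℤ)) : Matrix (Fin 2) (Fin 2) ℤ) = !![0, 1; -1, 0] := by
      rw [Matrix.SpecialLinearGroup.coe_inv, ModularGroup.coe_S, Matrix.adjugate_fin_two]; simp
    have : (γ * (ModularGroup.S * ModularGroup.T ^ j.val)⁻¹) 1 0 = γ 1 0 * (j.val : ℤ) - γ 1 1 := by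
      rw [_root_.mul_inv_rev]
      simp only [Matrix.SpecialLinearGroup.coe_mul, hT, hS]
      simp [Matrix.mul_apply, Fin.sum_univ_two]
      ring
    rw [this]
    push_cast
    rw [ZMod.natCast_zmod_val, hj, sub_self]

lemma gamma0_index : (CongruenceSubgroup.Gamma0 11).index ≤ 12 := by
  let f : Option (Fin 11) → SL(2, ℤ) ⧸ CongruenceSubgroup.Gamma0 11 := fun o ↦
    match o with
    | none => QuotientGroup.mk 1
    | some j => QuotientGroup.mk (ModularGroup.S * ModularGroup.T ^ (j : ℕ))⁻¹
  have hf : Function.Surjective f := by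
    intro q
    induction q using QuotientGroup.induction_on with | H g => ?_
    rcases gamma0_coset g⁻¹ with h | ⟨j, h⟩
    · exact ⟨none, by simpa [f, QuotientGroup.eq] using h⟩
    · refine ⟨some j, ?_⟩
      simp only [f]
      rw [eq_comm, QuotientGroup.eq]
      exact h
  have := Nat.card_le_card_of_surjective f hf
  simpa [Subgroup.index] using this

lemma gamma0_card : Nat.card (𝒮ℒ ⧸ ((CongruenceSubgroup.Gamma0 11 : Subgroup (GL (Fin 2) ℝ)).subgroupOf 𝒮ℒ)) ≤ 12 := by
  have h : (CongruenceSubgroup.Gamma0 11 : Subgroup (GL (Fin 2) ℝ)).relIndex 𝒮ℒ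
      = (CongruenceSubgroup.Gamma0 11).index := by
    rw [← Subgroup.index_comap, Subgroup.comap_map_eq_self_of_injective Matrix.SpecialLinearGroup.mapGL_injective]
  change (CongruenceSubgroup.Gamma0 11 : Subgroup (GL (Fin 2) ℝ)).relIndex 𝒮ℒ ≤ 12
  rw [h]
  exact gamma0_index

lemma levelOne_vanish {k : ℤ} (hk : k < 300) (f : ModularForm 𝒮ℒ k)
    (hf : (f : ℍ → ℂ) =O[atImInfty] fun τ : ℍ ↦ Real.exp (-2 * Real.pi * τ.im) ^ 25) : f = 0 := by
  have hinv : ∀ γ : SL(2, ℤ), (fun z ↦ f z / ModularForm.discriminant z ^ 25) ∣[k - 300] γ =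
      fun z ↦ f z / ModularForm.discriminant z ^ 25 := by
    intro γ
    have hγ : (γ : GL (Fin 2) ℝ) ∈ 𝒮ℒ := ⟨γ, rfl⟩
    have h1 := (CuspForm.discriminant.slash_action_eq' _ hγ)
    have h2 := f.slash_action_eq' _ hγ
    ext z
    have h1 := congrFun h1 z
    have h2 := congrFun h2 z
    rw [← ModularForm.SL_slash, ModularForm.SL_slash_apply] at h1 h2
    simp only [SlashInvariantForm.toFun_eq_coe, CuspForm.toSlashInvariantForm_coe, CuspForm.coe_discriminant, ModularForm.toSlashInvariantForm_coe] at h1 h2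
    rw [ModularForm.SL_slash_apply]
    have hd := denom_ne_zero γ z
    have e1 : k - 300 = k - 12 * 25 := by norm_num
    have hD := ModularForm.discriminant_ne_zero (γ • z)
    rw [← h1, ← h2, mul_pow, e1, neg_sub, zpow_sub₀ hd, _root_.zpow_mul, _root_.zpow_neg, _root_.zpow_neg]
    have hz1 : denom γ z ^ k ≠ 0 := zpow_ne_zero _ hd
    have hz2 : denom γ z ^ (12 : ℤ) ≠ 0 := zpow_ne_zero _ hd
    generalize denom γ z ^ k = a at *
    generalize denom γ z ^ (12 : ℤ) = b at *
    rw [show ((25 : ℤ)) = ((25 : ℕ) : ℤ) by norm_num, zpow_natCast]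
    field_simp
  let g : ModularForm 𝒮ℒ (k - 300) :=
    { toFun z := f z / ModularForm.discriminant z ^ 25
      slash_action_eq' := fun _ ⟨γ, hγ⟩ ↦ hγ ▸ hinv γ
      holo' := f.holo'.div (CuspForm.discriminant.holo'.pow 25) fun z ↦ pow_ne_zero _ (ModularForm.discriminant_ne_zero z)
      bdd_at_cusps' {c} hc := by
        rw [Subgroup.IsArithmetic.isCusp_iff_isCusp_SL2Z] at hc
        rw [OnePoint.isBoundedAt_iff_forall_SL2Z hc]
        intro γ _
        rw [hinv γ, IsBoundedAtImInfty, BoundedAtFilter]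
        exact (Asymptotics.div_isBoundedUnder_of_isBigO (hf.trans (ModularForm.exp_isBigO_discriminant.pow 25))).isBigO_one ℝ }
  have hg := ModularFormClass.levelOne_neg_weight_eq_zero (by lia : k - 300 < 0) g
  ext z
  have : f z / ModularForm.discriminant z ^ 25 = 0 := congrFun hg z
  simpa [ModularForm.discriminant_ne_zero] using this

lemma sturm11 (F : ModularForm (CongruenceSubgroup.Gamma0 11 : Subgroup (GL (Fin 2) ℝ)) 24)
    (hF : (F : ℍ → ℂ) =O[atImInfty] fun τ : ℍ ↦ Real.exp (-2 * Real.pi * τ.im) ^ 25) :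
    (F : ℍ → ℂ) = 0 := by
  classical
  rw [← ModularForm.norm_eq_zero_iff 𝒮ℒ]
  apply levelOne_vanish
  · have := gamma0_card
    lia
  · rw [ModularForm.coe_norm]
    let := Fintype.ofFinite (𝒮ℒ ⧸ ((CongruenceSubgroup.Gamma0 11 : Subgroup (GL (Fin 2) ℝ)).subgroupOf 𝒮ℒ))
    rw [← Finset.mul_prod_erase _ _ (Finset.mem_univ (QuotientGroup.mk 1))]
    have h1 : SlashInvariantForm.quotientFunc F (QuotientGroup.mk (1 : 𝒮ℒ)) = F := by
      refine (SlashInvariantForm.quotientFunc_mk F (1 : 𝒮ℒ)).trans ?_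
      simp
    rw [h1]
    have h2 : (∏ q ∈ Finset.univ.erase (QuotientGroup.mk (1 : 𝒮ℒ)), SlashInvariantForm.quotientFunc F q) =O[atImInfty] (fun _ ↦ (1 : ℝ)) := by
      rw [show (fun _ : ℍ ↦ (1 : ℝ)) = (fun x ↦ ∏ q ∈ Finset.univ.erase (QuotientGroup.mk (1 : 𝒮ℒ) : 𝒮ℒ ⧸ ((CongruenceSubgroup.Gamma0 11 : Subgroup (GL (Fin 2) ℝ)).subgroupOf 𝒮ℒ)), 1) by ext; simp, Finset.prod_fn]
      refine .finsetProd (Quotient.forall.mpr fun ⟨r, hr⟩ _ ↦ ?_)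
      obtain ⟨γ, rfl⟩ := hr
      refine Asymptotics.IsBigO.congr_left (ModularFormClass.bdd_at_infty_slash F γ⁻¹) ?_
      intro z
      rw [ModularForm.SL_slash]
      simp [SlashInvariantForm.quotientFunc_mk]
      rfl
    have h3 := hF.mul h2
    simp only [mul_one] at h3
    exact h3

/-- The point `11τ`. -/
noncomputable def mul11 (τ : ℍ) : ℍ := ⟨11 * (τ : ℂ), by simpa using τ.im_pos⟩

/-- The point `τ/11`. -/
noncomputable def div11 (τ : ℍ) : ℍ := ⟨(τ : ℂ) / 11, by
  have h : ((τ : ℂ) / 11).im = τ.im / 11 := by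
    rw [show (11 : ℂ) = ((11 : ℝ) : ℂ) by norm_num, Complex.div_ofReal_im]; rfl
  rw [h]; have := τ.im_pos; positivity⟩

lemma coe_mul11 (τ : ℍ) : (mul11 τ : ℂ) = 11 * (τ : ℂ) := rfl
lemma coe_div11 (τ : ℍ) : (div11 τ : ℂ) = (τ : ℂ) / 11 := rfl

/-- `12 E₂^{(11)}` in terms of Mathlib's `E2`. -/
noncomputable def fC (τ : ℍ) : ℂ := (11 * EisensteinSeries.E2 (mul11 τ) - EisensteinSeries.E2 τ) / 2

lemma sigma'_eq (k n : ℕ) : sigma' k n = ArithmeticFunction.sigma k n := by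
  rw [ArithmeticFunction.sigma_apply]; rfl

lemma summable_sigma1 (τ : ℍ) : Summable fun n : ℕ+ ↦ (sigma' 1 n : ℂ) * qExp τ ^ (n : ℕ) := by
  have := EisensteinSeries.summable_sigma_mul_cexp_pow (k := 2) (by norm_num) τ
  have h2 := this.comp_injective PNat.coe_injective
  refine h2.congr fun n ↦ ?_
  simp [sigma'_eq, qExp]

lemma E2_mathlib (τ : ℍ) : E2 τ = EisensteinSeries.E2 τ := by
  rw [EisensteinSeries.E2_eq_tsum_cexp, E2]
  simp [sigma'_eq, qExp]

lemma qExp_mul11 (τ : ℍ) : qExp (mul11 τ : ℂ) = qExp τ ^ 11 := by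
  rw [coe_mul11, qExp, qExp, ← Complex.exp_nat_mul]; congr 1; push_cast; ring

lemma fC_eq (τ : ℍ) : fC τ = 12 * E2N 11 τ := by
  rw [fC, ← E2_mathlib, ← E2_mathlib, E2N, E2, E2]
  have h1 := summable_sigma1 τ
  have h2 := summable_sigma1 (mul11 τ)
  simp only [qExp_mul11, ← pow_mul] at h2 ⊢
  have : ∀ n : ℕ+, (sigma' 1 n : ℂ) * (qExp τ ^ (n : ℕ) - ((11 : ℕ) : ℂ) * qExp τ ^ (11 * (n : ℕ))) =
     (sigma' 1 n : ℂ) * qExp τ ^ (n : ℕ) - 11 * ((sigma' 1 n : ℂ) * qExp τ ^ (11 * (n : ℕ))) := by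
    intro n; push_cast; ring
  rw [tsum_congr this, Summable.tsum_sub h1 (h2.mul_left 11), tsum_mul_left]
  push_cast; ring

lemma E4_mathlib (τ : ℍ) : E4 τ = ModularForm.E (k := 4) (by norm_num) τ := by
  rw [EisensteinSeries.q_expansion_bernoulli _ ⟨2, rfl⟩, E4, show bernoulli 4 = -1 / 30 by decide +kernel]
  simp [sigma'_eq, qExp]
  norm_num

lemma E6_mathlib (τ : ℍ) : E6 τ = ModularForm.E (k := 6) (by norm_num) τ := by
  rw [EisensteinSeries.q_expansion_bernoulli _ ⟨3, rfl⟩, E6, show bernoulli 6 = 1 / 42 by decide +kernel]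
  simp [sigma'_eq, qExp]
  norm_num

lemma E2_transform (γ : SL(2, ℤ)) (z : ℍ) : EisensteinSeries.E2 (γ • z) =
    EisensteinSeries.E2 z * ((γ 1 0 : ℂ) * z + γ 1 1) ^ 2
     - (1 / (2 * riemannZeta 2)) * (2 * Real.pi * Complex.I) * (γ 1 0 : ℂ) * ((γ 1 0 : ℂ) * z + γ 1 1) := by
  have h := congrFun (EisensteinSeries.E2_slash_action γ) z
  rw [ModularForm.SL_slash_apply] at h
  simp only [Pi.sub_apply, Pi.smul_apply, EisensteinSeries.D2, smul_eq_mul] at h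
  have hd := denom_ne_zero γ z
  have hd' : denom γ z = (γ 1 0 : ℂ) * z + γ 1 1 := ModularGroup.denom_apply γ z
  rw [hd'] at h hd
  have h2 : EisensteinSeries.E2 (γ • z) * (((γ 1 0 : ℂ) * z + γ 1 1) ^ 2)⁻¹ = EisensteinSeries.E2 z
     - (1 / (2 * riemannZeta 2)) * (2 * Real.pi * Complex.I * (γ 1 0 : ℂ) / ((γ 1 0 : ℂ) * z + γ 1 1)) := by
    rw [← h]; rfl
  generalize ((γ 1 0 : ℂ) * z + γ 1 1) = u at *
  have hE : EisensteinSeries.E2 (γ • z) = EisensteinSeries.E2 (γ • z) * (u ^ 2)⁻¹ * u ^ 2 := by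
    field_simp
  rw [hE, h2]
  field_simp

lemma fC_transform (γ : SL(2, ℤ)) (hγ : γ ∈ CongruenceSubgroup.Gamma0 11) (z : ℍ) :
    fC (γ • z) = fC z * ((γ 1 0 : ℂ) * z + γ 1 1) ^ 2 := by
  rw [CongruenceSubgroup.Gamma0_mem] at hγ
  obtain ⟨c, hc⟩ := (ZMod.intCast_zmod_eq_zero_iff_dvd (γ 1 0) 11).mp hγ
  push_cast at hc
  have hdet : γ 0 0 * γ 1 1 - γ 0 1 * γ 1 0 = 1 := by
    have := γ.det_coe; rwa [Matrix.det_fin_two] at this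
  let γ' : SL(2, ℤ) := ⟨!![γ 0 0, 11 * γ 0 1; c, γ 1 1], by
    rw [Matrix.det_fin_two_of]; rw [hc] at hdet; linear_combination hdet⟩
  have hm : mul11 (γ • z) = γ' • mul11 z := by
    apply UpperHalfPlane.ext
    rw [coe_mul11, UpperHalfPlane.coe_specialLinearGroup_apply, UpperHalfPlane.coe_specialLinearGroup_apply]
    simp [γ', coe_mul11, hc]
    ring
  rw [fC, hm, E2_transform, E2_transform, fC]
  simp [γ', coe_mul11, hc]
  ring

lemma fC_slash (γ : SL(2, ℤ)) (hγ : γ ∈ CongruenceSubgroup.Gamma0 11) : fC ∣[(2 : ℤ)] γ = fC := by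
  ext z
  have hd := denom_ne_zero γ z
  rw [ModularForm.SL_slash_apply, fC_transform γ hγ]
  rw [← ModularGroup.denom_apply γ z]
  rw [_root_.zpow_neg, show (2 : ℤ) = ((2 : ℕ) : ℤ) by norm_num, zpow_natCast]
  field_simp

lemma fC_slash_S (z : ℍ) : (fC ∣[(2 : ℤ)] ModularGroup.S) z =
    (EisensteinSeries.E2 (div11 z) / 11 - EisensteinSeries.E2 z) / 2 := by
  have hm : mul11 (ModularGroup.S • z) = ModularGroup.S • div11 z := by
    apply UpperHalfPlane.ext
    rw [coe_mul11, UpperHalfPlane.coe_specialLinearGroup_apply, UpperHalfPlane.coe_specialLinearGroup_apply]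
    simp [ModularGroup.S, coe_div11]
    ring
  have hz : (z : ℂ) ≠ 0 := ne_zero z
  rw [ModularForm.SL_slash_apply, ModularGroup.denom_S, fC, hm, E2_transform, E2_transform]
  simp [ModularGroup.S, coe_div11]
  field_simp
  ring

/-- The weight-24 homogenisation of the plane equation. -/
def PP {R : Type*} [CommRing R] (X Y c : R) : R :=
  -10061824 * Y ^ 4 + (235016704 * X * c - 4119072320 * c ^ 3) * Y ^ 3
  + (572544 * X ^ 3 - 1934162736 * X ^ 2 * c ^ 2 + 47640642720 * X * c ^ 4
      - 2204530508400 * c ^ 6) * Y ^ 2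
  + (-1351692 * X ^ 4 * c + 7092313360 * X ^ 3 * c ^ 3 - 301970625000 * X ^ 2 * c ^ 5
      + 2923075650000 * X * c ^ 7 - 5894869227500 * c ^ 9) * Y
  + (-29241 * X ^ 6 - 23955822 * X ^ 5 * c ^ 2 - 15183229435 * X ^ 4 * c ^ 4
      + 103990630700 * X ^ 3 * c ^ 6 - 2009614509375 * X ^ 2 * c ^ 8
      + 1296871230050 * X * c ^ 10 + 285311670611 * c ^ 12)

lemma PP_map {R S : Type*} [CommRing R] [CommRing S] (φ : R →+* S) (X Y c : R) :
    φ (PP X Y c) = PP (φ X) (φ Y) (φ c) := by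
  simp only [PP, map_add, map_sub, map_mul, map_pow, map_neg, map_ofNat]

lemma PP_hom {R : Type*} [CommRing R] (X Y c u : R) :
    PP (X * u ^ 4) (Y * u ^ 6) (c * u ^ 2) = PP X Y c * u ^ 24 := by
  simp only [PP]; ring

lemma PP_apply (X Y c : ℍ → ℂ) (τ : ℍ) : PP X Y c τ = PP (X τ) (Y τ) (c τ) :=
  PP_map (Pi.evalRingHom (fun _ : ℍ ↦ ℂ) τ) X Y c

lemma PP_bdd (X Y c : ℍ → ℂ) (hX : IsBoundedAtImInfty X) (hY : IsBoundedAtImInfty Y)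
    (hc : IsBoundedAtImInfty c) : IsBoundedAtImInfty (PP X Y c) := by
  let S := (Filter.boundedFilterSubalgebra ℂ (β := ℂ) atImInfty)
  have := PP_map (S.val : S →+* (ℍ → ℂ)) ⟨X, hX⟩ ⟨Y, hY⟩ ⟨c, hc⟩
  have h2 := (PP (⟨X, hX⟩ : S) ⟨Y, hY⟩ ⟨c, hc⟩).2
  have h3 : PP X Y c = (PP (⟨X, hX⟩ : S) ⟨Y, hY⟩ ⟨c, hc⟩ : S).1 := this.symm
  rw [h3]; exact h2

lemma fC_mdiff : MDiff fC := by
  have h1 := UpperHalfPlane.mdifferentiable_iff.mp E2_mdifferentiable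
  rw [UpperHalfPlane.mdifferentiable_iff]
  have h2 : DifferentiableOn ℂ (fun z : ℂ ↦ (EisensteinSeries.E2 ∘ ofComplex) (11 * z)) {z | 0 < z.im} := by
    refine h1.comp (by fun_prop) ?_
    intro z hz
    change 0 < z.im at hz
    change 0 < (11 * z).im
    simpa using hz
  have h3 := ((h2.const_mul 11).sub h1).div_const 2
  refine h3.congr ?_
  intro z hz
  have hz' : 0 < (11 * z).im := by simpa using hz
  simp only [Function.comp, fC, Pi.sub_apply]
  rw [ofComplex_apply_of_im_pos hz, ofComplex_apply_of_im_pos hz']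
  rfl

lemma tendsto_mul11 : Tendsto mul11 atImInfty atImInfty := by
  rw [atImInfty, tendsto_comap_iff]
  have : (UpperHalfPlane.im ∘ mul11) = fun z ↦ 11 * UpperHalfPlane.im z := by
    ext z; change (11 * (z : ℂ)).im = _; simp
  rw [this]
  exact tendsto_comap.const_mul_atTop (by norm_num)

lemma tendsto_div11 : Tendsto div11 atImInfty atImInfty := by
  rw [atImInfty, tendsto_comap_iff]
  have : (UpperHalfPlane.im ∘ div11) = fun z ↦ UpperHalfPlane.im z / 11 := by
    ext z
    change ((z : ℂ) / 11).im = _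
    rw [show (11 : ℂ) = ((11 : ℝ) : ℂ) by norm_num, Complex.div_ofReal_im]; rfl
  rw [this]
  exact tendsto_comap.atTop_div_const (by norm_num)

lemma bdd_comb (a b : ℂ) (f g : ℍ → ℂ) (hf : IsBoundedAtImInfty f) (hg : IsBoundedAtImInfty g) :
    IsBoundedAtImInfty (fun z ↦ a * f z + b * g z) := by
  have h := (Filter.boundedFilterSubalgebra ℂ (β := ℂ) atImInfty)
  rw [IsBoundedAtImInfty, BoundedAtFilter] at *
  exact (hf.const_mul_left a).add (hg.const_mul_left b)

lemma fC_bdd : IsBoundedAtImInfty fC := by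
  have h := bdd_comb (11 / 2) (-1 / 2) (EisensteinSeries.E2 ∘ mul11) EisensteinSeries.E2
    (EisensteinSeries.isBoundedAtImInfty_E2.comp_tendsto tendsto_mul11)
    EisensteinSeries.isBoundedAtImInfty_E2
  convert h using 2 with z
  simp only [fC, Function.comp]; ring

lemma fC_S_bdd : IsBoundedAtImInfty (fC ∣[(2 : ℤ)] ModularGroup.S) := by
  have h := bdd_comb (1 / 22) (-1 / 2) (EisensteinSeries.E2 ∘ div11) EisensteinSeries.E2
    (EisensteinSeries.isBoundedAtImInfty_E2.comp_tendsto tendsto_div11)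
    EisensteinSeries.isBoundedAtImInfty_E2
  convert h using 1
  ext z
  rw [fC_slash_S]
  simp only [Function.comp]; ring

lemma slash_T_bdd (f : ℍ → ℂ) (k : ℤ) (n : ℕ) (hf : IsBoundedAtImInfty f) :
    IsBoundedAtImInfty (f ∣[k] (ModularGroup.T ^ n)) := by
  induction n with
  | zero => simpa using hf
  | succ n ih =>
    rw [pow_succ, SlashAction.slash_mul]
    have : (f ∣[k] (ModularGroup.T ^ n)) ∣[k] ModularGroup.T =
        (f ∣[k] (ModularGroup.T ^ n)) ∘ fun z ↦ (1 : ℝ) +ᵥ z := by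
      ext z
      rw [ModularForm.SL_slash_apply, UpperHalfPlane.modular_T_smul, ModularGroup.denom_apply]
      simp [ModularGroup.T]
    rw [this]
    refine ih.comp_tendsto ?_
    rw [atImInfty, tendsto_comap_iff]
    have : (UpperHalfPlane.im ∘ fun z : ℍ ↦ (1 : ℝ) +ᵥ z) = UpperHalfPlane.im := by
      ext z; simp
    rw [this]; exact tendsto_comap

lemma fC_slash_bdd (γ : SL(2, ℤ)) : IsBoundedAtImInfty (fC ∣[(2 : ℤ)] γ) := by
  rcases gamma0_coset γ with h | ⟨j, h⟩
  · rw [fC_slash γ h]; exact fC_bdd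
  · have e : γ = (γ * (ModularGroup.S * ModularGroup.T ^ (j : ℕ))⁻¹) *
        (ModularGroup.S * ModularGroup.T ^ (j : ℕ)) := by group
    rw [e, SlashAction.slash_mul, fC_slash _ h, SlashAction.slash_mul]
    exact slash_T_bdd _ _ _ fC_S_bdd

/-- `-3 E₄`. -/
noncomputable def fX (τ : ℍ) : ℂ := -3 * ModularForm.E (k := 4) (by norm_num) τ
/-- `2 E₆`. -/
noncomputable def fY (τ : ℍ) : ℂ := 2 * ModularForm.E (k := 6) (by norm_num) τ

lemma E_slash_apply {k : ℕ} (hk : 3 ≤ k) (γ : SL(2, ℤ)) (z : ℍ) :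
    ModularForm.E hk (γ • z) = ModularForm.E hk z * denom γ z ^ k := by
  have hγ : (γ : GL (Fin 2) ℝ) ∈ 𝒮ℒ := ⟨γ, rfl⟩
  have h2 := congrFun ((ModularForm.E hk).slash_action_eq' _ hγ) z
  rw [← ModularForm.SL_slash, ModularForm.SL_slash_apply] at h2
  simp only [SlashInvariantForm.toFun_eq_coe, ModularForm.toSlashInvariantForm_coe] at h2
  rw [← h2, _root_.zpow_neg, zpow_natCast]
  have hd := denom_ne_zero γ z
  field_simp

lemma PP_slash (γ : SL(2, ℤ)) : (PP fX fY fC) ∣[(24 : ℤ)] γ = PP fX fY (fC ∣[(2 : ℤ)] γ) := by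
  ext z
  have hd := denom_ne_zero γ z
  rw [ModularForm.SL_slash_apply, PP_apply, PP_apply]
  have hC : fC (γ • z) = (fC ∣[(2 : ℤ)] γ) z * denom γ z ^ 2 := by
    rw [ModularForm.SL_slash_apply, _root_.zpow_neg, show (2 : ℤ) = ((2 : ℕ) : ℤ) by norm_num, zpow_natCast]
    field_simp
  have hX : fX (γ • z) = fX z * denom γ z ^ 4 := by
    rw [fX, fX, E_slash_apply]; ring
  have hY : fY (γ • z) = fY z * denom γ z ^ 6 := by
    rw [fY, fY, E_slash_apply]; ring
  rw [hC, hX, hY, PP_hom, _root_.zpow_neg, show (24 : ℤ) = ((24 : ℕ) : ℤ) by norm_num, zpow_natCast]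
  field_simp

lemma E_bdd {k : ℕ} (hk : 3 ≤ k) : IsBoundedAtImInfty (ModularForm.E hk) := by
  have h := ModularFormClass.bdd_at_infty_slash (ModularForm.E hk) 1
  simpa using h

lemma fX_bdd : IsBoundedAtImInfty fX := (E_bdd _).const_mul_left _
lemma fY_bdd : IsBoundedAtImInfty fY := (E_bdd _).const_mul_left _

lemma fX_mdiff : MDiff fX := by
  have := (ModularForm.E (k := 4) (by norm_num)).holo'
  exact (mdifferentiable_const (c := (-3 : ℂ))).mul this
lemma fY_mdiff : MDiff fY := by
  have := (ModularForm.E (k := 6) (by norm_num)).holo'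
  exact (mdifferentiable_const (c := (2 : ℂ))).mul this

lemma PP_mdiff (X Y c : ℍ → ℂ) (hX : MDiff X) (hY : MDiff Y) (hc : MDiff c) :
    MDiff (PP X Y c) := by
  rw [UpperHalfPlane.mdifferentiable_iff] at *
  have : PP X Y c ∘ ofComplex = fun z ↦ PP ((X ∘ ofComplex) z) ((Y ∘ ofComplex) z) ((c ∘ ofComplex) z) := by
    ext z; exact PP_apply _ _ _ _
  rw [this]
  generalize X ∘ ofComplex = X' at *
  generalize Y ∘ ofComplex = Y' at *
  generalize c ∘ ofComplex = c' at *
  unfold PP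
  fun_prop

/-- The weight-24 form to be shown to vanish. -/
noncomputable def FF : ModularForm (CongruenceSubgroup.Gamma0 11 : Subgroup (GL (Fin 2) ℝ)) 24 where
  toFun := PP fX fY fC
  slash_action_eq' := by
    rintro _ ⟨γ, hγ, rfl⟩
    have := PP_slash γ
    rw [fC_slash γ hγ] at this
    exact this
  holo' := PP_mdiff _ _ _ fX_mdiff fY_mdiff fC_mdiff
  bdd_at_cusps' {c} hc := by
    rw [Subgroup.IsArithmetic.isCusp_iff_isCusp_SL2Z] at hc
    rw [OnePoint.isBoundedAt_iff_forall_SL2Z hc]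
    intro γ _
    rw [PP_slash γ]
    exact PP_bdd _ _ _ fX_bdd fY_bdd (fC_slash_bdd γ)

/-- `f` is given on all of `ℍ` by the power series `p` in `q`. -/
def HasQ (f : ℍ → ℂ) (p : PowerSeries ℂ) : Prop :=
  ∀ τ : ℍ, HasSum (fun m ↦ p.coeff m * Function.Periodic.qParam 1 τ ^ m) (f τ)

lemma hs_congr {f g : ℕ → ℂ} {a : ℂ} (h : HasSum f a) (e : ∀ m, g m = f m) : HasSum g a := by
  rwa [funext e]

lemma HasQ.const (a : ℂ) : HasQ (fun _ ↦ a) (PowerSeries.C a) := by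
  intro τ
  have := hasSum_ite_eq 0 a
  refine hs_congr this fun m ↦ ?_
  rw [PowerSeries.coeff_C]
  split_ifs with h <;> simp [h]

lemma HasQ.add {f g : ℍ → ℂ} {p r : PowerSeries ℂ} (hf : HasQ f p) (hg : HasQ g r) :
    HasQ (f + g) (p + r) := by
  intro τ
  refine hs_congr ((hf τ).add (hg τ)) fun m ↦ ?_
  simp [add_mul]

lemma HasQ.neg {f : ℍ → ℂ} {p : PowerSeries ℂ} (hf : HasQ f p) :
    HasQ (-f) (-p) := by
  intro τ
  have := (hf τ).neg
  refine hs_congr this fun m ↦ ?_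
  simp

lemma HasQ.mul {f g : ℍ → ℂ} {p r : PowerSeries ℂ} (hf : HasQ f p) (hg : HasQ g r) :
    HasQ (f * g) (p * r) := by
  intro τ
  have h1 := (hf τ).summable.norm
  have h2 := (hg τ).summable.norm
  have h3 := (summable_norm_sum_mul_antidiagonal_of_summable_norm h1 h2).of_norm.hasSum
  rw [← tsum_mul_tsum_eq_tsum_sum_antidiagonal_of_summable_norm h1 h2, (hf τ).tsum_eq,
    (hg τ).tsum_eq] at h3
  refine hs_congr h3 fun m ↦ ?_
  rw [PowerSeries.coeff_mul, Finset.sum_mul]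
  refine Finset.sum_congr rfl fun x hx ↦ ?_
  rw [← Finset.HasAntidiagonal.mem_antidiagonal.mp hx, pow_add]; ring

/-- The ring of pairs (function, q-expansion). -/
def QR : Subring ((ℍ → ℂ) × PowerSeries ℂ) where
  carrier := {x | HasQ x.1 x.2}
  mul_mem' h1 h2 := HasQ.mul h1 h2
  one_mem' := by simpa using! HasQ.const 1
  add_mem' h1 h2 := HasQ.add h1 h2
  zero_mem' := by simpa using! HasQ.const 0
  neg_mem' h := HasQ.neg h

lemma HasQ.PP {f g h : ℍ → ℂ} {p r s : PowerSeries ℂ} (hf : HasQ f p) (hg : HasQ g r)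
    (hh : HasQ h s) : HasQ (PP f g h) (PP p r s) := by
  have h1 := (_root_.PP (⟨(f, p), hf⟩ : QR) ⟨(g, r), hg⟩ ⟨(h, s), hh⟩).2
  have h2 := PP_map ((RingHom.fst _ _).comp QR.subtype) (⟨(f, p), hf⟩ : QR) ⟨(g, r), hg⟩ ⟨(h, s), hh⟩
  have h3 := PP_map ((RingHom.snd _ _).comp QR.subtype) (⟨(f, p), hf⟩ : QR) ⟨(g, r), hg⟩ ⟨(h, s), hh⟩
  have h2' : (_root_.PP (⟨(f, p), hf⟩ : QR) ⟨(g, r), hg⟩ ⟨(h, s), hh⟩ : QR).1.1 = _root_.PP f g h := h2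
  have h3' : (_root_.PP (⟨(f, p), hf⟩ : QR) ⟨(g, r), hg⟩ ⟨(h, s), hh⟩ : QR).1.2 = _root_.PP p r s := h3
  rw [← h2', ← h3']
  exact h1

lemma HasQ.isBigO {f : ℍ → ℂ} {p : PowerSeries ℂ} (hf : HasQ f p) (hp : ∀ n < 25, p.coeff n = 0) :
    f =O[atImInfty] fun τ : ℍ ↦ Real.exp (-2 * Real.pi * τ.im) ^ 25 := by
  let g : ℍ → ℂ := fun τ ↦ f τ / Function.Periodic.qParam 1 τ ^ 25
  have hq : ∀ τ : ℍ, Function.Periodic.qParam 1 (τ : ℂ) ≠ 0 := fun τ ↦ Function.Periodic.qParam_ne_zero _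
  have hg : IsBoundedAtImInfty g := by
    refine isBoundedAtImInfty_of_hasSum_qExpansion (h := 1) (c := fun m ↦ p.coeff (m + 25)) one_pos ?_
    intro τ
    have h1 := (hasSum_nat_add_iff' 25).mpr (hf τ)
    rw [Finset.sum_eq_zero (fun n hn ↦ by rw [hp n (Finset.mem_range.mp hn), zero_mul]), sub_zero] at h1
    have h2 := h1.div_const (Function.Periodic.qParam 1 (τ : ℂ) ^ 25)
    refine hs_congr h2 fun m ↦ ?_
    have := hq τ
    rw [smul_eq_mul, pow_add]; field_simp
  have h1 : f = fun τ ↦ g τ * Function.Periodic.qParam 1 τ ^ 25 := by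
    ext τ; have := hq τ; simp only [g]; field_simp
  rw [h1]
  have h2 : (fun τ : ℍ ↦ Function.Periodic.qParam 1 (τ : ℂ) ^ 25) =O[atImInfty]
      fun τ : ℍ ↦ Real.exp (-2 * Real.pi * τ.im) ^ 25 := by
    refine Asymptotics.IsBigO.of_bound 1 (Eventually.of_forall fun τ ↦ ?_)
    rw [norm_pow, Function.Periodic.norm_qParam]
    simp
  have h3 := Asymptotics.IsBigO.mul (hg : g =O[atImInfty] (1 : ℍ → ℝ)) h2
  simpa using h3

/-- Integer coefficients of `-3 E₄`. -/
def cX (n : ℕ) : ℤ := if n = 0 then -3 else -720 * sigma' 3 n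
/-- Integer coefficients of `2 E₆`. -/
def cY (n : ℕ) : ℤ := if n = 0 then 2 else -1008 * sigma' 5 n
/-- Integer coefficients of `12 E₂^{(11)}`. -/
def cC (n : ℕ) : ℤ := if n = 0 then 5 else
  12 * sigma' 1 n - if 11 ∣ n then 132 * sigma' 1 (n / 11) else 0

/-- Complex power series of an integer one. -/
noncomputable abbrev toC : PowerSeries ℤ →+* PowerSeries ℂ := PowerSeries.map (Int.castRingHom ℂ)

lemma E_hasSum {k : ℕ} (hk : 3 ≤ k) (hk2 : Even k) (τ : ℍ) :
    HasSum (fun m ↦ (if m = 0 then 1 else -(2 * k / bernoulli k : ℂ) * (ArithmeticFunction.sigma (k - 1) m))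
      * Function.Periodic.qParam 1 τ ^ m) (ModularForm.E hk τ) := by
  have := ModularForm.hasSum_qExpansion one_pos (f := ModularForm.E hk) one_mem_strictPeriods_SL τ
  simpa only [EisensteinSeries.E_qExpansion_coeff hk hk2, smul_eq_mul] using this

lemma fX_hasQ : HasQ fX (toC (PowerSeries.mk cX)) := by
  intro τ
  have := (E_hasSum (k := 4) (by norm_num) ⟨2, rfl⟩ τ).mul_left (-3)
  rw [show bernoulli 4 = -1 / 30 by decide +kernel] at this
  refine hs_congr this fun m ↦ ?_
  simp only [toC, PowerSeries.coeff_map, PowerSeries.coeff_mk, cX, sigma'_eq]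
  split_ifs <;> push_cast <;> norm_num
  ring

lemma fY_hasQ : HasQ fY (toC (PowerSeries.mk cY)) := by
  intro τ
  have := (E_hasSum (k := 6) (by norm_num) ⟨3, rfl⟩ τ).mul_left 2
  rw [show bernoulli 6 = 1 / 42 by decide +kernel] at this
  refine hs_congr this fun m ↦ ?_
  simp only [toC, PowerSeries.coeff_map, PowerSeries.coeff_mk, cY, sigma'_eq]
  split_ifs <;> push_cast <;> norm_num
  ring

lemma fC_hasQ : HasQ fC (toC (PowerSeries.mk cC)) := by
  intro τ
  have h1 := EisensteinSeries.hasSum_qExpansion_E2 (z := τ)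
  have h2 := EisensteinSeries.hasSum_qExpansion_E2 (z := mul11 τ)
  have hq : Complex.exp (2 * Real.pi * Complex.I * (mul11 τ : ℂ)) =
    Complex.exp (2 * Real.pi * Complex.I * τ) ^ 11 := qExp_mul11 τ
  have hq1 : Function.Periodic.qParam 1 (τ : ℂ) = Complex.exp (2 * Real.pi * Complex.I * τ) := by
    simp [Function.Periodic.qParam]
  simp only [hq] at h2
  rw [hq1]
  generalize Complex.exp (2 * Real.pi * Complex.I * τ) = q at *
  have h3 : HasSum (fun n : ℕ ↦ (if 11 ∣ n then (if n = 0 then 1 else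
      -24 * (ArithmeticFunction.sigma 1 (n / 11) : ℂ)) else 0) * q ^ n) (EisensteinSeries.E2 (mul11 τ)) := by
    have hinj : Function.Injective (fun m : ℕ ↦ 11 * m) := fun a b h ↦ by simpa using h
    rw [← hinj.hasSum_iff]
    · refine hs_congr h2 fun m ↦ ?_
      simp [pow_mul]
    · intro n hn
      rw [if_neg, zero_mul]
      rintro ⟨m, rfl⟩
      exact hn ⟨m, rfl⟩
  have h4 := ((h3.mul_left 11).sub h1).div_const 2
  rw [fC]
  refine hs_congr h4 fun m ↦ ?_
  simp only [toC, PowerSeries.coeff_map, PowerSeries.coeff_mk, cC, sigma'_eq, smul_eq_mul]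
  by_cases h0 : m = 0
  · simp [h0]; norm_num
  · by_cases h11 : 11 ∣ m <;> simp [h0, h11] <;> ring

/-- `l` lists the first 25 coefficients of `p`. -/
def ListRep (l : List ℤ) (p : PowerSeries ℤ) : Prop := ∀ n < 25, p.coeff n = l.getD n 0

lemma rep_fma {u v w : List ℤ} {p r s : PowerSeries ℤ} (hu : ListRep u p) (hv : ListRep v r) (k : ℤ)
    (hw : ListRep w s) (t : List ℤ) (ht : ∀ n < 25, t.getD n 0 =
      ((List.range (n + 1)).map fun i ↦ u.getD i 0 * v.getD (n - i) 0).sum + k * w.getD n 0) :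
    ListRep t (p * r + PowerSeries.C k * s) := by
  intro n hn
  rw [ht n hn, map_add, PowerSeries.coeff_C_mul, hw n hn, PowerSeries.coeff_mul,
    Finset.Nat.sum_antidiagonal_eq_sum_range_succ_mk]
  congr 1
  change _ = ∑ i ∈ Finset.range (n + 1), _
  refine Finset.sum_congr rfl fun i hi ↦ ?_
  have := Finset.mem_range.mp hi
  rw [hu i (by lia), hv (n - i) (by lia)]

lemma rep_lin {u w : List ℤ} {p s : PowerSeries ℤ} (a : ℤ) (hu : ListRep u p) (k : ℤ)
    (hw : ListRep w s) (t : List ℤ) (ht : ∀ n < 25, t.getD n 0 = a * u.getD n 0 + k * w.getD n 0) :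
    ListRep t (PowerSeries.C a * p + PowerSeries.C k * s) := by
  intro n hn
  rw [ht n hn, map_add, PowerSeries.coeff_C_mul, PowerSeries.coeff_C_mul, hu n hn, hw n hn]

/-- Truncated coefficient list. -/
def lX : List ℤ :=
  [-3, -720, -6480, -20160, -52560, -90720, -181440, -247680, -421200, -545040, -816480, -959040,
   -1471680, -1582560, -2229120, -2540160, -3370320, -3538080, -4905360, -4939200, -6622560,
   -6935040, -8631360, -8760960, -11793600]

/-- Truncated coefficient list. -/
def lY : List ℤ :=
  [2, -1008, -33264, -245952, -1065456, -3151008, -8116416, -16942464, -34095600, -59767344,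
   -103983264, -162340416, -259971264, -374264352, -559101312, -768845952, -1091060208,
   -1431216864, -1972322352, -2495908800, -3330615456, -4133961216, -5357233728, -6487834752,
   -8319326400]

/-- Truncated coefficient list. -/
def lC : List ℤ :=
  [5, 12, 36, 48, 84, 72, 144, 96, 180, 156, 216, 12, 336, 168, 288, 288, 372, 216, 468, 240, 504,
   384, 36, 288, 720]

/-- Truncated coefficient list. -/
def lC2 : List ℤ :=
  [25, 120, 504, 1344, 3288, 6192, 11520, 17664, 28440, 38712, 57456, 70680, 98976, 111120, 152064,
   166752, 230232, 237168, 338040, 339360, 455760, 476736, 642456, 595296, 814176]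

/-- Truncated coefficient list. -/
def lC4 : List ℤ :=
  [625, 6000, 39600, 188160, 740976, 2453472, 7182720, 18727680, 44728560, 98250864, 202408416,
   391614000, 722368320, 1268747040, 2148542208, 3495868992, 5529907824, 8460603360, 12674314800,
   18461328960, 26494025760, 37114442112, 51495692400, 69924018240, 94463819712]

/-- Truncated coefficient list. -/
def lC6 : List ℤ :=
  [15625, 225000, 2025000, 13320000, 71181000, 321906960, 1274880384, 4506573312, 14464459656,
   42633097128, 116626299984, 298390768200, 719346859488, 1643174327088, 3576142262016,
   7446460127904, 14897663684424, 28727339447376, 53569222304040, 96835846078944, 170146350139248,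
   291145069826496, 486273772888200, 793974805101216, 1269826544427552]

/-- Truncated coefficient list. -/
def lC8 : List ℤ :=
  [390625, 7500000, 85500000, 710400000, 4752300000, 26860824000, 132509548800, 582761310720,
   2321850299616, 8481717483744, 28686094501824, 90530866259040, 268379562645120, 751555484455488,
   1997836881320448, 5062779876276864, 12276976902474720, 28583416822426560, 64085899695995232,
   138738688531880064, 290720560174673472, 590940349163517696, 1167534224511452640,
   2246142863858085504, 4214755341024803712]

/-- Truncated coefficient list. -/
def lC10 : List ℤ :=
  [9765625, 234375000, 3234375000, 32325000000, 258511875000, 1741828950000, 10218038400000,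
   53353636320000, 252016283403000, 1090136640024600, 4360455237221424, 16254927228057720,
   56842232030011680, 187490483825889360, 586090670873794560, 1743472021871814624,
   4953411274552789560, 13484367090620339760, 35273252357450694360, 88894771422717280800,
   216343561139073276048, 509538664519587819840, 1163654003244166195320, 2581431967027243853280,
   5571877162245659866080]

/-- Truncated coefficient list. -/
def lC12 : List ℤ :=
  [244140625, 7031250000, 113906250000, 1327500000000, 12319031250000, 96037042500000,
   650403594000000, 3914511616800000, 21285574085250000, 105883045113330000, 486584252344029600,
   2082154322500379280, 8350741686295682496, 31562899801475831136, 112954717218310854912,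
   384299858360422772928, 1247437899865719331920, 3875403819490112836512, 11555371784709441729936,
   33152498239227391293120, 91728885448175411882592, 245276573675676012040320,
   635025537118265632233552, 1594662190172079660372672, 3890326659169013421634368]

/-- Truncated coefficient list. -/
def lD0 : List ℤ :=
  [-103681858112, -663500705280, -3598920691200, -10273969950720, -25895987750400, -46826011192320,
   -90093143900160, -130968230707200, -216135452505600, -287551032000000, -428551857699840,
   -516526451381760, -753558684887040, -829639351280640, -1150243048488960, -1283843578337280,
   -1740423756203520, -1808420044078080, -2545252746186240, -2558642886912000, -3433720623805440,
   -3593560304455680, -4674836504655360, -4511039218882560, -6125342825502720]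

/-- Truncated coefficient list. -/
def lB0 : List ℤ :=
  [-48355786032, -232511760000, -978528104064, -2611057204224, -6389619988608, -12028276852992,
   -22385437102080, -34306858266624, -55248743744640, -75187367217792, -111596724884736,
   -137255714778240, -192278292512256, -215830248456960, -295392791568384, -323979857920512,
   -447235811528832, -460747214247168, -656632905713280, -659205375413760, -885305715552000,
   -926055621651456, -1247556288099456, -1156415375172096, -1581501234663936]

/-- Truncated coefficient list. -/
def lB1 : List ℤ :=
  [29920469058096, 321357557543040, 2370258996711552, 12157965591939072, 50769582236878464,
   174776026473605376, 526259141521044480, 1395350051194017792, 3371525369464371840,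
   7446612227538393216, 15399163775414562048, 29806830423153532800, 55016925072861224448,
   96493235888108424960, 163356808990927767552, 265330334918709259776, 419629475555251076736,
   641113482862217136384, 960773177137825825920, 1398207658211464527360, 2008282666695590972160,
   2811926188579023848448, 3905644224941982580608, 5301092317801318092288, 7168849647288588384768]

/-- Truncated coefficient list. -/
def lB2 : List ℤ :=
  [-34535550600924288, -518526174784458240, -4896547137427585536, -33793000375386249216,
   -189237196603779236352, -892905118063154500608, -3671184837196095068160,
   -13393804800849306587136, -44129429157559226503680, -132823769146736683120128,
   -369428450913949840763904, -957284067411699389360640, -2330223088030631292893184,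
   -5360707211773035051832320, -11727457994492037799243776, -24506991647389352879382528,
   -49150736376811546138956288, -94921982623413130470792192, -177172668765092561620492800,
   -320404717157966905479505920, -563069984818845665884584960, -963408309477162555951857664,
   -1608889185294855130572793344, -2626300502522479243246731264, -4199572554245581562590500864]

/-- Truncated coefficient list. -/
def lG0 : List ℤ :=
  [177311889076, 852050821440, 3583284897600, 9559319266560, 23390571259200, 44038229823360,
   81948700903680, 125613410265600, 202274724628800, 275294361000000, 408599585896320,
   502581034980480, 703958065201920, 790236994254720, 1081498622446080, 1186090951357440,
   1637433124080960, 1686852169395840, 2404116144083520, 2413523738976000, 3241344398325120,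
   3390535140080640, 4568166212273280, 4233867893498880, 5790332636962560]

/-- Truncated coefficient list. -/
def lG1 : List ℤ :=
  [-189263576292228, -1942044462599040, -13731244237342080, -68523332890775040,
   -280422411002213760, -952902737390880000, -2843017571241838080, -7497536921411374080,
   -18049098789409392000, -39795517955750163840, -82196402554069827840, -159078840314119534080,
   -293565109706070704640, -515109594702611877120, -872128097122872130560, -1417328400429619015680,
   -2241690805914785136000, -3426406657923845779200, -5134203308933562165120,
   -7473887354198730355200, -10732062274326345841920, -15029015271688571996160,
   -20867660426671337318400, -28327237569563209113600, -38295507883026626542080]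

/-- Truncated coefficient list. -/
def lG2 : List ℤ :=
  [46240847760126684, 799787929568201280, 8585121911406972480, 65427435323251718400,
   396323287350907498560, 1985818170027765605760, 8551994899184725167360, 32317171723223780590080,
   109373915765474275982400, 335913241711226531999040, 948640027394289291442560,
   2486074270075257849240960, 6102536516681008345378560, 14124002185863336663008640,
   31033700034305671562826240, 65045742262464658635832320, 130723073377992094501892160,
   252779434227933644942835840, 472187408917476863394411840, 854225135883237289715884800,
   1501417288038376415339706240, 2568744208497817425741696000, 4289335700353979514241322880,
   7000362175616291778522209280, 11192193289088488111501290240]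

/-- Truncated coefficient list. -/
def lG3 : List ℤ :=
  [-2441405835272567552, -79904293382245816320, -1405254687460196751360, -16680126455844873584640,
   -150496643928926587729920, -1092928928141169208258560, -6655944234890785276477440,
   -34921943490404817107189760, -161276092079329124572723200, -666267706694399618054215680,
   -2495911351164165286368768000, -8571672960187863666933565440, -27244006668434737032424857600,
   -80775993711957954119261736960, -224971544729933340772655923200,
   -592087431579293686019580518400, -1480318337712781798398023055360,
   -3531930455773636776009526947840, -8074817808950546342670207375360,
   -17752213226725106045227270348800, -37649782433647906266508505026560,
   -77244974165161185770129134632960, -153702591624426332367932550727680,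
   -297275178294078182661495268270080, -560010039896571343401362589573120]

/-- Truncated coefficient list. -/
def lH0 : List ℤ :=
  [-598807827, -2853645120, -11884252608, -31607126208, -77229835776, -145681706304, -270665582400,
   -415913228928, -668987268480, -911440266624, -1352531017152, -1665154210320, -2328018043392,
   -2615695303680, -3577636418688, -3920404411584, -5416845283584, -5578097394816, -7954588437120,
   -7985220606720, -10724455157760, -11217815252352, -15138171981072, -14004625781952,
   -19159398675072]

/-- Truncated coefficient list. -/
def lH1 : List ℤ :=
  [-9487721973394, -90659674039200, -595285333662816, -2817661381063296, -11061407011545312,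
   -36546873617492928, -106821367207401600, -278244076276897536, -664089781986263520,
   -1458259329887600928, -3003499902544444224, -5810922983011990560, -10718375757250602624,
   -18827032739336541120, -31882974354586526976, -51881897937950719488, -82069922137021667808,
   -125575351111072671552, -188112733461838764000, -274018489484876676480, -393226562340029920320,
   -550872158687553598464, -764277127964191878624, -1037808774825887960064,
   -1401940266267012315264]

/-- Truncated coefficient list. -/
def lH2 : List ℤ :=
  [1653316770607682, 30501030750461280, 339122286864305568, 2600960788062056448,
   15647880156943817376, 77434358147143959744, 328926094223491411200, 1227109001917555565568,
   4106948898777977607840, 12498930773764602855264, 35042519434333973332032,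
   91327838668922264811840, 223244751315104566284672, 515130598037320450194240,
   1129391896777164037329408, 2363704461337916288490624, 4745598118512246766509984,
   9171181091397261976088256, 17125356662895328214482080, 30976895286868404241503360,
   54442806478695539497287360, 93150221484236574698203392, 155551527980877033407889792,
   253893145892302058290676352, 405948983318614708037753472]

/-- Truncated coefficient list. -/
def lH3 : List ℤ :=
  [-789965618036432421, -16353999987401414880, -205513642226025317664, -1910578621724926141824,
   -14369237969051463846048, -90922732715109505211712, -497757559654284545635200,
   -2402284878531430721558784, -10382574093387295713939360, -40681484754537449362619232,
   -146061266102583701526922176, -484795131384438879522040800, -1499180152892588770363756416,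
   -4348161723949755950051991360, -11898362528200374760126980864, -30876216695572792313041892352,
   -76333921255490810982864534432, -180515075785484699440536043968,
   -409817210764355180558830910880, -896047930644831118538569895040,
   -1892320859757874733659906188480, -3869794970341676374272727781376,
   -7681140888206513374203944514336, -14828770520128670221555887822336,
   -27896977683553306201532917635456]

/-- Truncated coefficient list. -/
def lH4 : List ℤ :=
  [15034654960066328513, 921791439491404337760, 21704966007176145504672, 317522547557254903173312,
   3456926569117534527892704, 30332483805045857750741376, 224267810591769305403700800,
   1435875377421221536476849792, 8116343308065558298053218400, 41100215034033754839056800416,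
   188680080263855353761447255168, 793035271093746862203142034640, 3077637389314502053342093534848,
   11108864734363667388103935806400, 37534136122577056448667265206912,
   119378715838792257409909201336896, 359199775348045297075081739034336,
   1027015150468648109781364206669504, 2801371143808576476679107231185760,
   7315739370757223816512205386780800, 18349630620744875230787221341887040,
   44332996218329422701216691015936128, 103439903071174319018423385497401488,
   233632257016334092771544922811434048, 511906740216897096773970577404185088]

/-- Truncated coefficient list. -/
def lH5 : List ℤ :=
  [24552204702564686336, -11584228205738375792640, -793730516116035149715456,
   -22477699097001724264390656, -395493967173678738820872192, -5097515616976876120620085248,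
   -52355928582592462353422131200, -449738761837331011415613751296,
   -3331539062029645117201068226560, -21733841022833875877457250756608,
   -126815323761603540063063065677824, -669910835849359926482632268789760,
   -3235772265936111431575495809343488, -14410434725099262300444093254283264,
   -59597497017987616867260644834033664, -230325762392622158212397150937907200,
   -836387931584196097876277896261367808, -2867740709145802890110380016748564480,
   -9324527349364166302656433792685881344, -28864256734931785060045295309061611520,
   -85361748879729794259078175185539371008, -241941591115629850624202599774599512064,
   -659094495727591295994642982799505426432, -1730238291496133354484899279514694582272,
   -4387480982127002206588245495020053733376]

/-- Truncated coefficient list. -/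
def lD : List ℤ :=
  [-518409290560, -4561685823744, -29689158811392, -123419652627456, -422886032978688,
   -1150692173397504, -2802795546866688, -5892336020846592, -11658889937836800, -20829156416992512,
   -36089050397225472, -57723898151119104, -91334410761157632, -134551924149505536,
   -198615765926946816, -274991879117316096, -386195563446246144, -510019186261750272,
   -693500314260462336, -884002864125772800, -1170259959078609408, -1455225465971478528,
   -1888792040530720512, -2290826957282574336, -2935983015458565120]

/-- Truncated coefficient list. -/
def lG : List ℤ :=
  [-12207029176362837760, -428818336934499892224, -8073015567957745984512,
   -103257430570600661569536, -1007274390035849199571968, -7945428887125718260598784,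
   -52737539628780325447446528, -302564378145379409673265152, -1531571517423407797359621120,
   -6948520321971776569535572992, -28618290784228589121610708992, -108123930488408668952162724864,
   -378068713050378490987938435072, -1232661968216746506457096882176,
   -3772000043164416692839760879616, -10894463008972191335905683111936,
   -29847876240287612201237594256384, -77911042378315178930095568074752,
   -194519335458564891974721221784576, -466135448733102649046021175029760,
   -1075479569008417114985854083299328, -2395750686293340773441985339998208,
   -5165634323495896689876428554785792, -10805095511492047511702941714415616,
   -21970946400441836529169903112294400]

/-- Truncated coefficient list. -/
def lK0 : List ℤ :=
  [-518429414208, -4551543505152, -29354462297856, -120944926891008, -412165602226944,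
   -1118987285478912, -2721129597563904, -5721863929952256, -11315826011462400, -20227787920717056,
   -35042789095911936, -56090457457240320, -88718625657732096, -130786142110207488,
   -192990186927433728, -267255886465179648, -375217507659946752, -495618534070350336,
   -673655153883372288, -858889469060121600, -1136747892548657664, -1413630275793260544,
   -1834888497632720640, -2225547505866866688, -2852275417423211520]

/-- Truncated coefficient list. -/
def lK1 : List ℤ :=
  [-34536587459752704, -518012701021946880, -4874772854464773120, -33484741672805130240,
   -186467836656678128640, -874765947783065978880, -3576779790248898293760,
   -12985395062901229854720, -42604665037137833241600, -127796686057637124572160,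
   -354478023918447605729280, -916621312220833000614912, -2227687983137408360509440,
   -5118876113163300961228800, -11188944284670505720995840, -23368185455754307024834560,
   -46848180234480975815592960, -90453600634106075878287360, -168807319098962558528793600,
   -305257855685891144790528000, -536436965080272174903429120, -917855731860882243259023360,
   -1532846840600313983215936512, -2502273784636019392978636800, -4001352708869111993975746560]

/-- Truncated coefficient list. -/
def lK2 : List ℤ :=
  [-12276102351282343168, -395041482177113060352, -6411783265775339129856,
   -72685111770950642454528, -647536787701790615460864, -4785677455807423224870912,
   -30318192348045865766866944, -168198094407656060527435776, -830735405333934238289525760,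
   -3700488945317546982607266816, -15030374889639865188459718656, -56181194662966458254362543104,
   -194805209055630372443190374400, -630956732012586164836395325440,
   -1920604209405924444855578763264, -5523793394613684893557253922816,
   -15082322306163930928580586126336, -39261048565801606565464646313984,
   -97805255799582813019779341614080, -233955275091940432609570659225600,
   -539006552044638836408388072400896, -1199297750582128227658880918962176,
   -2583463959258665693508799661693952, -5399860590518248485291952188186624,
   -10973488250794353307477865778475008]

/-- Truncated coefficient list. -/
def lK3 : List ℤ :=
  [0, 0, 0, 0, 0, 0, 0, 0, 0, 0, 0, 0, 0, 0, 0, 0, 0, 0, 0, 0, 0, 0, 0, 0, 0]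

lemma PP_coeff_zero (n : ℕ) (hn : n < 25) :
    (PP (PowerSeries.mk cX) (PowerSeries.mk cY) (PowerSeries.mk cC)).coeff n = 0 := by
  have hX : ListRep lX (PowerSeries.mk cX) := by
    intro n hn; rw [PowerSeries.coeff_mk]; revert n; decide +kernel
  have hY : ListRep lY (PowerSeries.mk cY) := by
    intro n hn; rw [PowerSeries.coeff_mk]; revert n; decide +kernel
  have hC : ListRep lC (PowerSeries.mk cC) := by
    intro n hn; rw [PowerSeries.coeff_mk]; revert n; decide +kernel
  have hC2 := rep_fma hC hC (0) hC lC2 (by decide +kernel)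
  have hC4 := rep_fma hC2 hC2 (0) hC lC4 (by decide +kernel)
  have hC6 := rep_fma hC4 hC2 (0) hC lC6 (by decide +kernel)
  have hC8 := rep_fma hC4 hC4 (0) hC lC8 (by decide +kernel)
  have hC10 := rep_fma hC6 hC4 (0) hC lC10 (by decide +kernel)
  have hC12 := rep_fma hC6 hC6 (0) hC lC12 (by decide +kernel)
  have hD0 := rep_lin (235016704) hX (-4119072320) hC2 lD0 (by decide +kernel)
  have hB0 := rep_lin (572544) hX (-1934162736) hC2 lB0 (by decide +kernel)
  have hB1 := rep_fma hB0 hX (47640642720) hC4 lB1 (by decide +kernel)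
  have hB2 := rep_fma hB1 hX (-2204530508400) hC6 lB2 (by decide +kernel)
  have hG0 := rep_lin (-1351692) hX (7092313360) hC2 lG0 (by decide +kernel)
  have hG1 := rep_fma hG0 hX (-301970625000) hC4 lG1 (by decide +kernel)
  have hG2 := rep_fma hG1 hX (2923075650000) hC6 lG2 (by decide +kernel)
  have hG3 := rep_fma hG2 hX (-5894869227500) hC8 lG3 (by decide +kernel)
  have hH0 := rep_lin (-29241) hX (-23955822) hC2 lH0 (by decide +kernel)
  have hH1 := rep_fma hH0 hX (-15183229435) hC4 lH1 (by decide +kernel)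
  have hH2 := rep_fma hH1 hX (103990630700) hC6 lH2 (by decide +kernel)
  have hH3 := rep_fma hH2 hX (-2009614509375) hC8 lH3 (by decide +kernel)
  have hH4 := rep_fma hH3 hX (1296871230050) hC10 lH4 (by decide +kernel)
  have hH5 := rep_fma hH4 hX (285311670611) hC12 lH5 (by decide +kernel)
  have hD := rep_fma hC hD0 (0) hC lD (by decide +kernel)
  have hG := rep_fma hC hG3 (0) hC lG (by decide +kernel)
  have hK0 := rep_lin (-10061824) hY (1) hD lK0 (by decide +kernel)
  have hK1 := rep_fma hK0 hY (1) hB2 lK1 (by decide +kernel)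
  have hK2 := rep_fma hK1 hY (1) hG lK2 (by decide +kernel)
  have hK3 := rep_fma hK2 hY (1) hH5 lK3 (by decide +kernel)
  have h0 := hK3 n hn
  rw [(by decide +kernel : ∀ n < 25, lK3.getD n 0 = 0) n hn] at h0
  rw [← h0]
  congr 1
  simp only [map_neg, map_ofNat, map_one, map_zero, PP]
  ring

lemma FF_zero (τ : ℍ) : PP (fX τ) (fY τ) (fC τ) = 0 := by
  have h := HasQ.PP fX_hasQ fY_hasQ fC_hasQ
  rw [← PP_map] at h
  have h2 := sturm11 FF (h.isBigO fun n hn ↦ by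
    rw [toC, PowerSeries.coeff_map, PP_coeff_zero n hn, map_zero])
  have h3 := congrFun h2 τ
  rw [← PP_apply]
  exact h3

/-- The pair `(a₄, a₆)` at level `11` satisfies a degree-6 plane defining equation
of `X₀(11)`. -/
theorem X0_11_plane_equation (τ : ℍ) (h : E2N 11 (τ : ℂ) ≠ 0) :
    -29241 * a4 11 (τ : ℂ) ^ 6 - 23955822 * a4 11 (τ : ℂ) ^ 5
      - 1351692 * a4 11 (τ : ℂ) ^ 4 * a6 11 (τ : ℂ)
      + 572544 * a4 11 (τ : ℂ) ^ 3 * a6 11 (τ : ℂ) ^ 2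
      - 15183229435 * a4 11 (τ : ℂ) ^ 4
      + 7092313360 * a4 11 (τ : ℂ) ^ 3 * a6 11 (τ : ℂ)
      - 1934162736 * a4 11 (τ : ℂ) ^ 2 * a6 11 (τ : ℂ) ^ 2
      + 235016704 * a4 11 (τ : ℂ) * a6 11 (τ : ℂ) ^ 3
      - 10061824 * a6 11 (τ : ℂ) ^ 4
      + 103990630700 * a4 11 (τ : ℂ) ^ 3
      - 301970625000 * a4 11 (τ : ℂ) ^ 2 * a6 11 (τ : ℂ)
      + 47640642720 * a4 11 (τ : ℂ) * a6 11 (τ : ℂ) ^ 2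
      - 4119072320 * a6 11 (τ : ℂ) ^ 3
      - 2009614509375 * a4 11 (τ : ℂ) ^ 2
      + 2923075650000 * a4 11 (τ : ℂ) * a6 11 (τ : ℂ)
      - 2204530508400 * a6 11 (τ : ℂ) ^ 2
      + 1296871230050 * a4 11 (τ : ℂ)
      - 5894869227500 * a6 11 (τ : ℂ)
      + 285311670611 = 0 := by
  have h0 := FF_zero τ
  have hc : fC τ ≠ 0 := by rw [fC_eq]; exact mul_ne_zero (by norm_num) h
  have hx : a4 11 (τ : ℂ) = fX τ / fC τ ^ 2 := by
    rw [fC_eq, a4, fX, ← E4_mathlib]; field_simp; ring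
  have hy : a6 11 (τ : ℂ) = fY τ / fC τ ^ 3 := by
    rw [fC_eq, a6, fY, ← E6_mathlib]; field_simp; ring
  rw [hx, hy]
  generalize fX τ = X at *
  generalize fY τ = Y at *
  generalize fC τ = c at *
  have key : PP X Y c / c ^ 12 = 0 := by rw [h0, zero_div]
  rw [← key, PP]
  field_simp
  ring
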